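/- arXiv:1611.04477 — 2 statements merged into one kernel-verified Lean document; each statement's English description precedes it below -/
import Mathlib

section
/- For every nonzero ξ₀ ∈ ℝ², the sequence of iterates Mⁿξ₀ of the matrix M = (1/2)·[[1, 4], [−1, 4]] diverges: ‖Mⁿξ₀‖ → ∞ as n → ∞. -/
open Matrix Filter

/-- A positive definite quadratic form which `(1/2)[[1,4],[−1,4]]` scales by its determinant `2`. -/
def scaledForm (v : Fin 2 → ℝ) : ℝ := v 0 ^ 2 - 3 * v 0 * v 1 + 4 * v 1 ^ 2

lemma scaledForm_pos {v : Fin 2 → ℝ} (hv : v ≠ 0) : 0 < scaledForm v := by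
  unfold scaledForm
  by_cases h1 : v 1 = 0
  · have h0 : v 0 ≠ 0 := fun h0 => hv (by ext i; fin_cases i <;> simp [h0, h1])
    have := pow_pos (abs_pos.mpr h0) 2
    rw [sq_abs] at this
    simpa [h1] using this
  · have := pow_pos (abs_pos.mpr h1) 2
    rw [sq_abs] at this
    nlinarith [sq_nonneg (2 * v 0 - 3 * v 1)]

lemma scaledForm_le (v : Fin 2 → ℝ) : scaledForm v ≤ 6 * (v 0 ^ 2 + v 1 ^ 2) := by
  unfold scaledForm
  nlinarith [sq_nonneg (v 0 + v 1), sq_nonneg (v 0), sq_nonneg (v 1)]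

lemma scaledForm_mulVec (v : Fin 2 → ℝ) :
    scaledForm (((1 / 2 : ℝ) • !![1, 4; -1, 4]) *ᵥ v) = 2 * scaledForm v := by
  simp [scaledForm, Matrix.mulVec, dotProduct, Fin.sum_univ_two]
  ring

lemma scaledForm_pow_mulVec (v : Fin 2 → ℝ) (n : ℕ) :
    scaledForm (((1 / 2 : ℝ) • !![1, 4; -1, 4]) ^ n *ᵥ v) = 2 ^ n * scaledForm v := by
  induction n with
  | zero => simp
  | succ n ih => rw [pow_succ', ← mulVec_mulVec, scaledForm_mulVec, ih, pow_succ']; ring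

/-- For every nonzero `ξ₀ ∈ ℝ²`, the iterates `Mⁿξ₀` of the matrix
`M = (1/2)[[1,4],[−1,4]]` diverge in Euclidean norm: `‖Mⁿξ₀‖ → ∞`. -/
theorem stmt_17 (M : Matrix (Fin 2) (Fin 2) ℝ) (hM : M = (1 / 2 : ℝ) • !![1, 4; -1, 4]) :
    ∀ ξ₀ : Fin 2 → ℝ, ξ₀ ≠ 0 →
      Tendsto (fun n : ℕ => ‖(WithLp.equiv 2 (Fin 2 → ℝ)).symm (M ^ n *ᵥ ξ₀)‖)
        atTop atTop := by
  intro ξ₀ hξ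
  subst hM
  have hlim : Tendsto (fun n : ℕ => √((2 : ℝ) ^ n * (scaledForm ξ₀ / 6))) atTop atTop :=
    Real.tendsto_sqrt_atTop.comp ((tendsto_pow_atTop_atTop_of_one_lt one_lt_two).atTop_mul_const
      (div_pos (scaledForm_pos hξ) (by norm_num)))
  refine tendsto_atTop_mono (fun n => ?_) hlim
  rw [EuclideanSpace.norm_eq]
  apply Real.sqrt_le_sqrt
  have h := scaledForm_le (((1 / 2 : ℝ) • !![1, 4; -1, 4]) ^ n *ᵥ ξ₀)
  rw [scaledForm_pow_mulVec] at h
  simp only [Fin.sum_univ_two, Real.norm_eq_abs, sq_abs, WithLp.equiv_symm_apply]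
  linarith
end

section
/- For every ξ₀ ∈ ℝ², the sequence of iterates Mⁿξ₀ of the matrix M = (1/5)·[[4, 4], [−1, 4]] converges to 0 as n → ∞. -/
open Matrix Filter

/-- The quadratic form `x² + 4y²` is scaled by `4/5` under each application of `M`. -/
lemma quadratic_form_pow_mulVec {M : Matrix (Fin 2) (Fin 2) ℝ}
    (hM : M = (1 / 5 : ℝ) • !![4, 4; -1, 4]) (ξ : Fin 2 → ℝ) (n : ℕ) :
    (M ^ n *ᵥ ξ) 0 ^ 2 + 4 * (M ^ n *ᵥ ξ) 1 ^ 2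
      = (4 / 5 : ℝ) ^ n * (ξ 0 ^ 2 + 4 * ξ 1 ^ 2) := by
  induction n with
  | zero => simp
  | succ n ih =>
    rw [pow_succ' (4 / 5 : ℝ), mul_assoc, ← ih, pow_succ' M, ← mulVec_mulVec]
    generalize M ^ n *ᵥ ξ = v
    simp only [hM, mulVec, dotProduct, Fin.sum_univ_two, Matrix.smul_apply, smul_eq_mul,
      of_apply, cons_val_zero, cons_val_one]
    ring

/-- For every `ξ₀ ∈ ℝ²`, the iterates `Mⁿξ₀` of the matrix
`M = (1/5)[[4,4],[−1,4]]` converge to `0` as `n → ∞`. -/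
theorem stmt_18 (M : Matrix (Fin 2) (Fin 2) ℝ) (hM : M = (1 / 5 : ℝ) • !![4, 4; -1, 4]) :
    ∀ ξ₀ : Fin 2 → ℝ,
      Tendsto (fun n : ℕ => M ^ n *ᵥ ξ₀) atTop (nhds 0) := by
  intro ξ
  have hlim : Tendsto (fun n : ℕ => (4 / 5 : ℝ) ^ n * (ξ 0 ^ 2 + 4 * ξ 1 ^ 2)) atTop (nhds 0) := by
    simpa using (tendsto_pow_atTop_nhds_zero_of_lt_one (r := (4 / 5 : ℝ))
      (by norm_num) (by norm_num)).mul_const (ξ 0 ^ 2 + 4 * ξ 1 ^ 2)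
  rw [tendsto_pi_nhds]
  intro i
  have hsq : Tendsto (fun n : ℕ => (M ^ n *ᵥ ξ) i ^ 2) atTop (nhds 0) := by
    refine squeeze_zero (fun n => sq_nonneg _) (fun n => ?_) hlim
    rw [← quadratic_form_pow_mulVec hM]
    generalize M ^ n *ᵥ ξ = v
    fin_cases i <;> dsimp <;> nlinarith [sq_nonneg (v 0), sq_nonneg (v 1)]
  have habs := hsq.sqrt
  simp only [Real.sqrt_sq_eq_abs, Real.sqrt_zero] at habs
  exact (tendsto_zero_iff_abs_tendsto_zero _).mpr habs
end
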